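/- Let F be a field of characteristic zero and let (T, X, Y, Z, V, U) be polynomials in F[t] satisfying the short system X² − (T²−1)Y² = 1, Y − (T−1)Z = V, V·U = 1. Then V and U are nonzero constants, and exactly one of the following three cases holds: (a) T = 1 or T = −1, in which case X = 1 or X = −1; (b) T is a constant different from ±1, in which case X and Y are also constants in F; (c) T is not constant, in which case either (X = ±1 and Y = 0) or there exists a positive integer N with X = ±X_N and Y = ±Y_N, the signs chosen independently, where X_N = Σ_{k=0}^{⌊N/2⌋} C(N,2k)·(T²−1)^k·T^{N−2k} and Y_N = Σ_{k=0}^{⌊N/2⌋} C(N,2k+1)·(T²−1)^k·T^{N−1−2k}. -/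

import Mathlib

open Finset Polynomial

/-- `X_N = Σ_{k=0}^{⌊N/2⌋} C(N,2k)·(T²−1)^k·T^{N−2k}`. -/
noncomputable def pellX {R : Type*} [CommRing R] (T : R) (N : ℕ) : R :=
  ∑ k ∈ Finset.range (N / 2 + 1),
    (N.choose (2 * k) : R) * (T ^ 2 - 1) ^ k * T ^ (N - 2 * k)

/-- `Y_N = Σ_{k=0}^{⌊N/2⌋} C(N,2k+1)·(T²−1)^k·T^{N−1−2k}`. -/
noncomputable def pellY {R : Type*} [CommRing R] (T : R) (N : ℕ) : R :=
  ∑ k ∈ Finset.range (N / 2 + 1),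
    (N.choose (2 * k + 1) : R) * (T ^ 2 - 1) ^ k * T ^ (N - 1 - 2 * k)

theorem sq_eq_one_pm {R : Type*} [CommRing R] [IsDomain R] {a : R} (h : a ^ 2 = 1) :
    a = 1 ∨ a = -1 := by
  have : a ^ 2 = 1 ^ 2 := by rw [h, one_pow]
  exact sq_eq_sq_iff_eq_or_eq_neg.1 this

theorem pellX_eq {R : Type*} [CommRing R] (T : R) (N M : ℕ) (h : N / 2 + 1 ≤ M) :
    pellX T N = ∑ k ∈ Finset.range M,
      (N.choose (2 * k) : R) * (T ^ 2 - 1) ^ k * T ^ (N - 2 * k) := by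
  unfold pellX
  apply Finset.sum_subset (Finset.range_subset_range.2 h)
  intro k _ hk
  rw [Finset.mem_range, not_lt] at hk
  rw [Nat.choose_eq_zero_of_lt (by omega)]
  simp

theorem pellY_eq {R : Type*} [CommRing R] (T : R) (N M : ℕ) (h : N / 2 + 1 ≤ M) :
    pellY T N = ∑ k ∈ Finset.range M,
      (N.choose (2 * k + 1) : R) * (T ^ 2 - 1) ^ k * T ^ (N - 1 - 2 * k) := by
  unfold pellY
  apply Finset.sum_subset (Finset.range_subset_range.2 h)
  intro k _ hk
  rw [Finset.mem_range, not_lt] at hk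
  rw [Nat.choose_eq_zero_of_lt (by omega)]
  simp

theorem pellX_succ {R : Type*} [CommRing R] (T : R) (N : ℕ) :
    pellX T (N + 1) = T * pellX T N + (T ^ 2 - 1) * pellY T N := by
  rw [pellX_eq T (N + 1) (N + 2) (by omega), pellX_eq T N (N + 2) (by omega),
    pellY_eq T N (N + 1) (by omega), Finset.sum_range_succ', Finset.sum_range_succ' _ (N + 1),
    mul_add, Finset.mul_sum, Finset.mul_sum, add_right_comm, ← Finset.sum_add_distrib]
  congr 1
  · apply Finset.sum_congr rfl
    intro k _
    rw [show 2 * (k + 1) = (2 * k + 1) + 1 by ring, Nat.choose_succ_succ,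
      show N + 1 - (2 * k + 1 + 1) = N - 1 - 2 * k by omega]
    by_cases hk : 2 * k + 2 ≤ N
    · rw [show N - 1 - 2 * k = (N - (2 * k + 1 + 1)) + 1 by omega]
      push_cast
      ring
    · rw [Nat.choose_eq_zero_of_lt (show N < (2 * k + 1).succ by omega)]
      push_cast
      ring
  · simp [pow_succ']

theorem pellY_succ {R : Type*} [CommRing R] (T : R) (N : ℕ) :
    pellY T (N + 1) = pellX T N + T * pellY T N := by
  rw [pellY_eq T (N + 1) (N + 2) (by omega), pellX_eq T N (N + 2) (by omega),
    pellY_eq T N (N + 2) (by omega), Finset.mul_sum, ← Finset.sum_add_distrib]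
  apply Finset.sum_congr rfl
  intro k _
  rw [Nat.choose_succ_succ, show N + 1 - 1 - 2 * k = N - 2 * k by omega]
  by_cases hk : 2 * k + 1 ≤ N
  · rw [show N - 2 * k = (N - 1 - 2 * k) + 1 by omega]
    push_cast
    ring
  · rw [Nat.choose_eq_zero_of_lt (show N < (2 * k).succ by omega)]
    push_cast
    ring

theorem pellX_zero {R : Type*} [CommRing R] (T : R) : pellX T 0 = 1 := by
  simp [pellX]

theorem pellY_zero {R : Type*} [CommRing R] (T : R) : pellY T 0 = 0 := by
  simp [pellY]

/-- Up to independent signs, `(X, Y)` is `(X_N, Y_N)`. -/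
def IsPell {R : Type*} [CommRing R] (T X Y : R) : Prop :=
  ∃ N : ℕ, (X = pellX T N ∨ X = -pellX T N) ∧ (Y = pellY T N ∨ Y = -pellY T N)

theorem IsPell.neg_left {R : Type*} [CommRing R] {T X Y : R} (h : IsPell T (-X) Y) :
    IsPell T X Y := by
  obtain ⟨N, hX, hY⟩ := h
  refine ⟨N, ?_, hY⟩
  rcases hX with hX | hX
  · right; rw [← hX, neg_neg]
  · left; exact neg_injective hX

theorem IsPell.step {R : Type*} [CommRing R] {T X Y : R} (h : IsPell T X Y) :
    IsPell T (T * X + (T ^ 2 - 1) * Y) (X + T * Y) := by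
  obtain ⟨N, hX, hY⟩ := h
  have key : ∀ N : ℕ, IsPell T (T * pellX T N - (T ^ 2 - 1) * pellY T N)
      (pellX T N - T * pellY T N) := by
    intro N
    cases N with
    | zero => exact ⟨1, by left; rw [pellX_succ, pellX_zero, pellY_zero]; ring,
        by left; rw [pellY_succ, pellX_zero, pellY_zero]; ring⟩
    | succ N => exact ⟨N, by left; rw [pellX_succ, pellY_succ]; ring,
        by right; rw [pellX_succ, pellY_succ]; ring⟩
  have key2 : ∀ {A B : R}, IsPell T A B → IsPell T (-A) (-B) := by
    rintro A B ⟨N, hA, hB⟩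
    refine ⟨N, ?_, ?_⟩
    · rcases hA with rfl | rfl <;> simp
    · rcases hB with rfl | rfl <;> simp
  rcases hX with rfl | rfl <;> rcases hY with rfl | rfl
  · exact ⟨N + 1, by left; rw [pellX_succ], by left; rw [pellY_succ]⟩
  · convert key N using 1 <;> ring
  · convert key2 (key N) using 1 <;> ring
  · exact ⟨N + 1, by right; rw [pellX_succ]; ring, by right; rw [pellY_succ]; ring⟩

theorem isPell_of_eq {F : Type*} [Field F] [CharZero F] (T : Polynomial F)
    (hT : 0 < T.natDegree) (n : ℕ) : ∀ X Y : Polynomial F, Y.natDegree = n →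
    X ^ 2 - (T ^ 2 - 1) * Y ^ 2 = 1 → IsPell T X Y := by
  induction n using Nat.strong_induction_on with
  | _ n ih =>
  intro X Y hn h1
  by_cases hY : Y = 0
  · subst hY
    have : X ^ 2 = 1 := by linear_combination h1
    exact ⟨0, by rw [pellX_zero]; exact sq_eq_one_pm this,
      by rw [pellY_zero]; simp⟩
  by_cases hY1 : Y ^ 2 = 1
  · refine ⟨1, ?_, ?_⟩
    · rw [pellX_succ, pellX_zero, pellY_zero]
      have : X ^ 2 = T ^ 2 := by linear_combination h1 + (T ^ 2 - 1) * hY1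
      simpa using sq_eq_sq_iff_eq_or_eq_neg.1 this
    · rw [pellY_succ, pellX_zero, pellY_zero]
      simpa using sq_eq_one_pm hY1
  have hAB : (T * Y - X) * (T * Y + X) = Y ^ 2 - 1 := by linear_combination -h1
  have hne : (T * Y - X) * (T * Y + X) ≠ 0 := by rw [hAB]; exact sub_ne_zero.2 hY1
  have hA := left_ne_zero_of_mul hne
  have hB := right_ne_zero_of_mul hne
  have hT0 : T ≠ 0 := by rintro rfl; simp at hT
  have hd1 : (T * Y - X).natDegree + (T * Y + X).natDegree ≤ 2 * Y.natDegree := by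
    rw [← natDegree_mul hA hB, hAB]
    refine (natDegree_sub_le _ _).trans ?_
    simp [natDegree_pow]
  have hd2 : T.natDegree + Y.natDegree ≤ max (T * Y - X).natDegree (T * Y + X).natDegree := by
    rw [← natDegree_mul hT0 hY]
    have h2 : (T * Y - X) + (T * Y + X) = C (2 : F) * (T * Y) := by
      rw [show (C (2 : F)) = 2 from rfl]; ring
    rw [← natDegree_C_mul (a := (2 : F)) two_ne_zero, ← h2]
    exact natDegree_add_le _ _
  rcases le_total (T * Y - X).natDegree (T * Y + X).natDegree with hle | hle
  · rw [max_eq_right hle] at hd2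
    have := (ih _ (show (T * Y - X).natDegree < n by omega) (T * X - (T ^ 2 - 1) * Y)
      (T * Y - X) rfl (by linear_combination h1)).step
    convert this using 1 <;> ring
  · rw [max_eq_left hle] at hd2
    have := (ih _ (show (T * Y + X).natDegree < n by omega) (-T * X - (T ^ 2 - 1) * Y)
      (T * Y + X) rfl (by linear_combination h1)).step
    apply IsPell.neg_left
    convert this using 1 <;> ring

theorem const_of_sq {K : Type*} [Field K] [CharZero K] (s : K) (hs : s ≠ 0)
    (X Y : Polynomial K) (h : X ^ 2 - C (s ^ 2) * Y ^ 2 = 1) :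
    X.natDegree = 0 ∧ Y.natDegree = 0 := by
  have h' : (X - C s * Y) * (X + C s * Y) = 1 := by
    rw [← h, C_pow]; ring
  have u1 := natDegree_eq_zero_of_isUnit (IsUnit.of_mul_eq_one _ h')
  have u2 := natDegree_eq_zero_of_isUnit (IsUnit.of_mul_eq_one_right _ h')
  constructor
  · have e : C (2 : K) * X = (X - C s * Y) + (X + C s * Y) := by
      rw [show (C (2 : K)) = 2 from rfl]; ring
    rw [← natDegree_C_mul (a := (2 : K)) two_ne_zero, e]
    have := natDegree_add_le (X - C s * Y) (X + C s * Y)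
    omega
  · have e : C (2 * s : K) * Y = (X + C s * Y) - (X - C s * Y) := by
      rw [C_mul, show (C (2 : K)) = 2 from rfl]; ring
    rw [← natDegree_C_mul (a := (2 * s : K)) (mul_ne_zero two_ne_zero hs), e]
    have := natDegree_sub_le (X + C s * Y) (X - C s * Y)
    omega

theorem const_of_ne {F : Type*} [Field F] [CharZero F] (d : F) (hd : d ≠ 0)
    (X Y : Polynomial F) (h : X ^ 2 - C d * Y ^ 2 = 1) :
    X.natDegree = 0 ∧ Y.natDegree = 0 := by
  let f := algebraMap F (AlgebraicClosure F)
  have : CharZero (AlgebraicClosure F) := charZero_of_injective_algebraMap f.injective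
  obtain ⟨s, hs⟩ := IsAlgClosed.exists_pow_nat_eq (f d) (n := 2) (by norm_num)
  have hs0 : s ≠ 0 := by
    rintro rfl
    apply hd
    apply f.injective
    rw [← hs]; simp
  have := const_of_sq s hs0 (X.map f) (Y.map f) (by
    have := congrArg (Polynomial.map f) h
    simpa [hs] using this)
  simpa [natDegree_map] using this

/-- Description of the solutions of the short system `X² − (T²−1)Y² = 1`,
`Y − (T−1)Z = V`, `V·U = 1` over `F[t]`, `F` a field of characteristic zero:
`V` and `U` are nonzero constants, and exactly one of the three cases
(a) `T = ±1` and then `X = ±1`;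
(b) `T` a constant `≠ ±1` and then `X`, `Y` constants;
(c) `T` nonconstant and then `(X, Y) = (±1, 0)` or `(±X_N, ±Y_N)`, `N > 0`;
holds (the cases being mutually exclusive by their conditions on `T`). -/
theorem short_system_classification {F : Type*} [Field F] [CharZero F]
    (T X Y Z V U : Polynomial F)
    (h1 : X ^ 2 - (T ^ 2 - 1) * Y ^ 2 = 1)
    (h2 : Y - (T - 1) * Z = V)
    (h3 : V * U = 1) :
    ((∃ v : F, v ≠ 0 ∧ V = C v) ∧ (∃ u : F, u ≠ 0 ∧ U = C u)) ∧
    (((T = 1 ∨ T = -1) ∧ (X = 1 ∨ X = -1)) ∨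
     ((∃ c : F, c ≠ 1 ∧ c ≠ -1 ∧ T = C c) ∧
        (∃ a : F, X = C a) ∧ (∃ b : F, Y = C b)) ∨
     (0 < T.natDegree ∧
        (((X = 1 ∨ X = -1) ∧ Y = 0) ∨
          ∃ N : ℕ, 0 < N ∧ (X = pellX T N ∨ X = -pellX T N) ∧
            (Y = pellY T N ∨ Y = -pellY T N)))) := by
  refine ⟨⟨?_, ?_⟩, ?_⟩
  · obtain ⟨v, hv, e⟩ := Polynomial.isUnit_iff.1 (IsUnit.of_mul_eq_one _ h3)
    exact ⟨v, hv.ne_zero, e.symm⟩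
  · obtain ⟨v, hv, e⟩ := Polynomial.isUnit_iff.1 (IsUnit.of_mul_eq_one_right _ h3)
    exact ⟨v, hv.ne_zero, e.symm⟩
  · by_cases hT : 0 < T.natDegree
    · right; right
      refine ⟨hT, ?_⟩
      obtain ⟨N, hX, hY⟩ := isPell_of_eq T hT _ X Y rfl h1
      rcases Nat.eq_zero_or_pos N with rfl | hN
      · left
        rw [pellX_zero] at hX
        rw [pellY_zero] at hY
        exact ⟨hX, by simpa using hY⟩
      · right
        exact ⟨N, hN, hX, hY⟩
    · by_cases hT1 : T ^ 2 = 1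
      · left
        refine ⟨sq_eq_one_pm hT1, sq_eq_one_pm ?_⟩
        linear_combination h1 + Y ^ 2 * hT1
      · right; left
        have hc := eq_C_of_natDegree_eq_zero (show T.natDegree = 0 by omega)
        generalize T.coeff 0 = c at hc
        subst hc
        have hd : c ^ 2 - 1 ≠ 0 := by
          intro h
          apply hT1
          rw [← C_pow, sub_eq_zero.1 h, C_1]
        obtain ⟨hX, hY⟩ := const_of_ne (c ^ 2 - 1) hd X Y (by simpa using h1)
        refine ⟨⟨c, ?_, ?_, rfl⟩, ⟨_, eq_C_of_natDegree_eq_zero hX⟩,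
          ⟨_, eq_C_of_natDegree_eq_zero hY⟩⟩
        · rintro rfl; simp at hd
        · rintro rfl; simp at hd
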